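/- arXiv:1808.05065 — 2 statements merged into one kernel-verified Lean document; each statement's English description precedes it below -/
import Mathlib

section
/- Let α be a type, R a binary relation on α, and θ₁, θ₂, C, C' : α → α functions such that: (i) for all a b, R a b implies R (θ₁ a) (θ₁ b); (ii) for all a b, R a b implies R (θ₂ a) (θ₂ b); (iii) for all a b, R a b implies R (C' a) (C' b); (iv) θ₁ ∘ C = C' ∘ θ₁. Suppose Relation.TransGen R s (C t) and θ₂ (θ₁ s) = θ₁ t (the semi-unification condition). Then Relation.TransGen R (θ₁ s) ((C' ∘ θ₂) (θ₁ s)), and consequently there exists g : ℕ → α with g 0 = θ₁ s and Relation.TransGen R (g n) (g (n+1)) for all n : ℕ; that is, θ₁ s is non-terminating with respect to R. -/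
/-- If `f` preserves `R` and `a` reaches `f a` in at least one step, then consecutive iterates of `f`
on `a` are related by the transitive closure of `R`. -/
theorem Relation.TransGen.iterate_succ {α : Type*} {R : α → α → Prop} {f : α → α}
    (hf : ∀ a b : α, R a b → R (f a) (f b)) {a : α} (ha : Relation.TransGen R a (f a)) (n : ℕ) :
    Relation.TransGen R (f^[n] a) (f^[n + 1] a) := by
  induction n with
  | zero => exact ha
  | succ n ih =>
    rw [Function.iterate_succ_apply' f n, Function.iterate_succ_apply' f (n + 1)]
    exact ih.lift f hf

theorem semiunification_loop_criterion {α : Type*} (R : α → α → Prop)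
    (θ₁ θ₂ C C' : α → α)
    (h1 : ∀ a b : α, R a b → R (θ₁ a) (θ₁ b))
    (h2 : ∀ a b : α, R a b → R (θ₂ a) (θ₂ b))
    (h3 : ∀ a b : α, R a b → R (C' a) (C' b))
    (h4 : θ₁ ∘ C = C' ∘ θ₁)
    (s t : α)
    (hst : Relation.TransGen R s (C t))
    (hsemi : θ₂ (θ₁ s) = θ₁ t) :
    Relation.TransGen R (θ₁ s) ((C' ∘ θ₂) (θ₁ s)) ∧
    ∃ g : ℕ → α, g 0 = θ₁ s ∧ ∀ n : ℕ, Relation.TransGen R (g n) (g (n + 1)) := by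
  have hloop : Relation.TransGen R (θ₁ s) ((C' ∘ θ₂) (θ₁ s)) := by
    have hC : θ₁ (C t) = C' (θ₁ t) := congrFun h4 t
    rw [Function.comp_apply, hsemi, ← hC]
    exact hst.lift θ₁ h1
  exact ⟨hloop, fun n => (C' ∘ θ₂)^[n] (θ₁ s), rfl,
    hloop.iterate_succ fun a b hab => h3 _ _ (h2 a b hab)⟩
end

section
/- With T and R as given, the ground term t = f(s(h), s(h), s(h)) is non-terminating with respect to R: there exists g : ℕ → T with g 0 = t and R (g n) (g (n+1)) for all n : ℕ. -/
/-- Ground terms over the signature f (ternary), s (unary), constants 0, 1, h. -/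
inductive T : Type
  | f : T → T → T → T
  | s : T → T
  | zero : T
  | one : T
  | h : T

/-- One-step rewrite relation of the TRS
    { f(s(0), s(1), x) → f(x, x, x),  h → 0,  h → 1 },
    closed under contexts. -/
inductive R : T → T → Prop
  | rule1 (u : T) : R (T.f (T.s T.zero) (T.s T.one) u) (T.f u u u)
  | rule2 : R T.h T.zero
  | rule3 : R T.h T.one
  | ctx_s {u u' : T} : R u u' → R (T.s u) (T.s u')
  | ctx_f1 {u u' : T} (v w : T) : R u u' → R (T.f u v w) (T.f u' v w)
  | ctx_f2 {u u' : T} (v w : T) : R u u' → R (T.f v u w) (T.f v u' w)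
  | ctx_f3 {u u' : T} (v w : T) : R u u' → R (T.f v w u) (T.f v w u')

/-- The cyclic rewrite sequence of period three starting at `f(s(h), s(h), s(h))`. -/
def rewriteCycle : ℕ → T
  | 0 => T.f (T.s T.h) (T.s T.h) (T.s T.h)
  | 1 => T.f (T.s T.zero) (T.s T.h) (T.s T.h)
  | 2 => T.f (T.s T.zero) (T.s T.one) (T.s T.h)
  | n + 3 => rewriteCycle n

theorem rewriteCycle_step : ∀ n : ℕ, R (rewriteCycle n) (rewriteCycle (n + 1))
  | 0 => R.ctx_f1 _ _ (R.ctx_s R.rule2)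
  | 1 => R.ctx_f2 _ _ (R.ctx_s R.rule3)
  | 2 => R.rule1 (T.s T.h)
  | n + 3 => rewriteCycle_step n

theorem fshh_nonterminating :
    ∃ g : ℕ → T, g 0 = T.f (T.s T.h) (T.s T.h) (T.s T.h) ∧
      ∀ n : ℕ, R (g n) (g (n + 1)) :=
  ⟨rewriteCycle, rfl, rewriteCycle_step⟩
end
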